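/- Let R be an F-finite reduced Noetherian ring of characteristic p > 0. If R is regular, then R is strongly F-regular. -/

import Mathlib

universe u

/-- `R` is *strongly F-regular* (in characteristic `p`): for every `c` not in any minimal
prime, the `R`-module map `R → R^{1/q}`, `1 ↦ c^{1/q}`, splits for some `q = pᵉ`.
Identifying `R^{1/q}` with `R` via the `q`-th power map, a splitting is an additive map
`ψ : R → R` with `ψ(r^q · x) = r · ψ(x)` and `ψ(c) = 1`. -/
def StronglyFRegular (p : ℕ) (R : Type u) [CommRing R] : Prop :=
  ∀ c : R, (∀ P ∈ minimalPrimes R, c ∉ P) →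
    ∃ (e : ℕ) (ψ : R →+ R), 0 < e ∧
      (∀ r x : R, ψ (r ^ p ^ e * x) = r * ψ x) ∧ ψ c = 1

/-- `R` is a *regular* ring: every localization at a prime is a regular local ring, i.e. its
maximal ideal is generated by `dim` many elements. -/
def IsRegularCommRing (R : Type u) [CommRing R] : Prop :=
  ∀ (P : Ideal R) [P.IsPrime],
    ∃ s : Finset (Localization.AtPrime P),
      Ideal.span (s : Set (Localization.AtPrime P)) =
        IsLocalRing.maximalIdeal (Localization.AtPrime P) ∧
      (s.card : WithBot (WithTop ℕ)) = ringKrullDim (Localization.AtPrime P)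

open IsLocalRing RingTheory.Sequence
open scoped Pointwise

theorem RingTheory.Sequence.IsWeaklyRegular.map_pow_append {A : Type*} [CommRing A] [IsLocalRing A]
    {M : Type*} [AddCommGroup M] [Module A M] [IsNoetherian A M] (k : ℕ) (hk : k ≠ 0)
    (as bs : List A) (hmem : ∀ r ∈ as ++ bs, r ∈ maximalIdeal A)
    (h : IsWeaklyRegular M (as ++ bs)) :
    IsWeaklyRegular M (as.map (· ^ k) ++ bs) := by
  induction as generalizing bs with
  | nil => simpa using h
  | cons a as ih =>
    have hperm : (a :: as ++ bs).Perm ((as ++ bs) ++ [a]) :=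
      (List.perm_append_singleton a (as ++ bs)).symm
    have h₁ := isWeaklyRegular_of_perm_of_subset_maximalIdeal h hperm hmem
    have h₂ : IsWeaklyRegular M ((as ++ bs) ++ [a ^ k]) := by
      rw [isWeaklyRegular_append_iff, isWeaklyRegular_singleton_iff] at h₁ ⊢
      exact ⟨h₁.1, h₁.2.pow k⟩
    have hak : a ^ k ∈ maximalIdeal A :=
      Ideal.pow_mem_of_mem _ (hmem a (by simp)) k (Nat.pos_of_ne_zero hk)
    have hmem' : ∀ r ∈ as ++ (bs ++ [a ^ k]), r ∈ maximalIdeal A := by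
      intro r hr
      simp only [List.mem_append, List.mem_singleton] at hr
      rcases hr with hr | hr | rfl
      · exact hmem r (by simp [hr])
      · exact hmem r (by simp [hr])
      · exact hak
    have h₃ := ih (bs ++ [a ^ k]) hmem' (by rwa [← List.append_assoc])
    refine isWeaklyRegular_of_perm_of_subset_maximalIdeal h₃ ?_ ?_
    · rw [← List.append_assoc]
      exact List.perm_append_singleton _ _
    · intro r hr
      simp only [List.mem_append, List.mem_map, List.mem_singleton] at hr
      rcases hr with ⟨s, hs, rfl⟩ | hr | rfl
      · exact Ideal.pow_mem_of_mem _ (hmem s (by simp [hs])) k (Nat.pos_of_ne_zero hk)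
      · exact hmem r (by simp [hr])
      · exact hak

theorem Module.free_of_isWeaklyRegular_of_ofList_eq_maximalIdeal {A : Type*} [CommRing A]
    [IsLocalRing A] [IsNoetherianRing A] {M : Type*} [AddCommGroup M] [Module A M]
    [Module.Finite A M] (rs : List A) (hrs : Ideal.ofList rs = maximalIdeal A)
    (h : IsWeaklyRegular M rs) : Module.Free A M := by
  induction hn : rs.length generalizing A M rs with
  | zero =>
    obtain rfl := List.length_eq_zero_iff.mp hn
    have hA : IsField A := isField_iff_maximalIdeal_eq.mpr (by simpa using hrs.symm)
    let := hA.toField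
    exact Module.Free.of_divisionRing A M
  | succ n ih =>
    obtain ⟨x, rs, rfl⟩ := List.exists_cons_of_length_eq_add_one hn
    rw [isWeaklyRegular_cons_iff'] at h
    have hx : x ∈ maximalIdeal A := hrs ▸ Ideal.subset_span (by simp)
    have : Nontrivial (A ⧸ Ideal.span {x}) := Ideal.Quotient.nontrivial_iff.mpr
      (((Ideal.span_singleton_le_iff_mem _).mpr hx).trans_lt
        (maximalIdeal.isMaximal A).ne_top.lt_top).ne
    have : IsLocalRing (A ⧸ Ideal.span {x}) :=
      .of_surjective' (Ideal.Quotient.mk _) Ideal.Quotient.mk_surjective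
    have : Module.Finite (A ⧸ Ideal.span {x}) (QuotSMulTop x M) :=
      Module.Finite.of_restrictScalars_finite A _ _
    have hmax : Ideal.ofList (rs.map (Ideal.Quotient.mk (Ideal.span {x}))) =
        maximalIdeal (A ⧸ Ideal.span {x}) := by
      rw [← map_maximalIdeal_of_surjective _ Ideal.Quotient.mk_surjective, ← hrs,
        ← Ideal.map_ofList, Ideal.ofList_cons, Ideal.map_sup, Ideal.map_quotient_self, bot_sup_eq]
    have : Module.FinitePresentation A M := Module.finitePresentation_of_finite A M
    exact (Module.free_quotSMulTop_iff_free A M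
      (by rwa [jacobson_eq_maximalIdeal _ bot_ne_top]) h.1).mp
        (ih _ hmax h.2 (by simpa using hn))

theorem IsLocalRing.spanFinrank_maximalIdeal_quotient_lt {A : Type*} [CommRing A]
    [IsLocalRing A] [IsNoetherianRing A] {x : A} (hx : x ∈ maximalIdeal A)
    (hx' : x ∉ maximalIdeal A ^ 2) :
    ((maximalIdeal A).map (Ideal.Quotient.mk (Ideal.span {x}))).spanFinrank <
      (maximalIdeal A).spanFinrank := by
  classical
  have hfg : (maximalIdeal A).FG := IsNoetherian.noetherian _
  have hfin := Submodule.FG.finite_generators hfg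
  obtain ⟨s, hs⟩ := hfin.exists_finset_coe
  have hspan : Submodule.span A (s : Set A) = maximalIdeal A := by
    rw [hs]; exact Submodule.span_generators _
  have hcard : s.card = (maximalIdeal A).spanFinrank := by
    rw [← Submodule.FG.generators_ncard hfg, ← hs, Set.ncard_coe_finset]
  have hsm : ∀ a ∈ s, a ∈ maximalIdeal A := fun a ha ↦ hspan ▸ Submodule.subset_span ha
  rw [← hspan, Submodule.mem_span_finset] at hx
  obtain ⟨f, -, hf⟩ := hx
  obtain ⟨a, ha, hfa⟩ : ∃ a ∈ s, IsUnit (f a) := by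
    by_contra! hcon
    refine hx' (hf ▸ Ideal.sum_mem _ fun a ha ↦ ?_)
    rw [pow_two]
    exact Ideal.mul_mem_mul ((mem_maximalIdeal _).mpr (hcon a ha)) (hsm a ha)
  have hle : (maximalIdeal A).map (Ideal.Quotient.mk (Ideal.span {x})) =
      Ideal.span ((s.erase a).image (Ideal.Quotient.mk (Ideal.span {x})) : Set _) := by
    rw [← hspan, ← Ideal.span, Ideal.map_span]
    refine le_antisymm (Ideal.span_le.mpr ?_) (Ideal.span_mono ?_)
    · rintro _ ⟨b, hb, rfl⟩
      by_cases hba : b = a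
      · subst hba
        have h0 : ∑ c ∈ s, Ideal.Quotient.mk (Ideal.span {x}) (f c * c) = 0 := by
          rw [← map_sum]
          exact Ideal.Quotient.eq_zero_iff_mem.mpr
            (by simp [← hf])
        rw [← Finset.add_sum_erase _ _ ha, map_mul, add_eq_zero_iff_eq_neg] at h0
        refine (Ideal.unit_mul_mem_iff_mem _ (hfa.map (Ideal.Quotient.mk _))).mp ?_
        rw [h0]
        refine neg_mem (Ideal.sum_mem _ fun c hc ↦ ?_)
        rw [map_mul]
        exact Ideal.mul_mem_left _ _ (Ideal.subset_span
          (Finset.mem_coe.mpr (Finset.mem_image_of_mem _ hc)))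
      · exact Ideal.subset_span (Finset.mem_coe.mpr
          (Finset.mem_image_of_mem _ (Finset.mem_erase.mpr ⟨hba, hb⟩)))
    · rw [Finset.coe_image]
      exact Set.image_mono (Finset.coe_subset.mpr (Finset.erase_subset _ _))
  rw [hle, ← hcard]
  calc _ ≤ _ := Submodule.spanFinrank_span_le_ncard_of_finite (Finset.finite_toSet _)
    _ ≤ (s.erase a).card := by rw [Set.ncard_coe_finset]; exact Finset.card_image_le
    _ < s.card := Finset.card_erase_lt_of_mem ha

theorem IsRegularLocalRing.exists_mem_maximalIdeal {A : Type*} [CommRing A] [IsRegularLocalRing A]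
    (h : maximalIdeal A ≠ ⊥) :
    ∃ x ∈ maximalIdeal A, x ∉ maximalIdeal A ^ 2 ∧ ∀ P ∈ minimalPrimes A, x ∉ P := by
  classical
  have hfg : (maximalIdeal A).FG := IsNoetherian.noetherian _
  by_contra! hcon
  obtain ⟨s, hs⟩ := (minimalPrimes.finite_of_isNoetherianRing A).exists_finset_coe
  have hsub : (maximalIdeal A : Set A) ⊆
      ⋃ I ∈ ((insert (maximalIdeal A ^ 2) s : Finset (Ideal A)) : Set (Ideal A)), (I : Set A) := by
    intro x hx
    by_cases hx2 : x ∈ maximalIdeal A ^ 2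
    · exact Set.mem_biUnion (by simp) hx2
    · obtain ⟨P, hP, hxP⟩ := hcon x hx hx2
      exact Set.mem_biUnion (by simp [hs, hP]) hxP
  obtain ⟨I, hI, hle⟩ := (Ideal.subset_union_prime (f := id) (maximalIdeal A ^ 2)
    (maximalIdeal A ^ 2) (fun I hI hne _ ↦ by
      have : I ∈ minimalPrimes A := hs ▸ Finset.mem_coe.mpr (Finset.mem_of_mem_insert_of_ne hI hne)
      exact this.1.1)).mp hsub
  rcases Finset.mem_insert.mp hI with rfl | hI
  · exact h (Submodule.eq_bot_of_le_smul_of_le_jacobson_bot (maximalIdeal A) _ hfg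
      (by rwa [smul_eq_mul, ← pow_two]) (maximalIdeal_le_jacobson _))
  · have hI : I ∈ minimalPrimes A := hs ▸ Finset.mem_coe.mpr hI
    have hprime : I.IsPrime := hI.1.1
    obtain rfl : maximalIdeal A = I := le_antisymm hle (le_maximalIdeal hprime.ne_top)
    have hd : ringKrullDim A = 0 := by
      rw [← maximalIdeal_height_eq_ringKrullDim, Ideal.height_eq_zero_iff.mpr hI]
      rfl
    have h0 := IsRegularLocalRing.spanFinrank_maximalIdeal (R := A)
    rw [hd] at h0
    exact h ((Submodule.spanFinrank_eq_zero_iff_eq_bot hfg).mp (by exact_mod_cast h0))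

theorem IsRegularLocalRing.isDomain_and_exists_isWeaklyRegular (A : Type*) [CommRing A]
    [IsRegularLocalRing A] :
    IsDomain A ∧ ∃ rs : List A, Ideal.ofList rs = maximalIdeal A ∧ IsWeaklyRegular A rs := by
  induction hn : (maximalIdeal A).spanFinrank using Nat.strong_induction_on generalizing A with
  | _ n ih =>
  subst hn
  by_cases hbot : maximalIdeal A = ⊥
  · have hA : IsField A := isField_iff_maximalIdeal_eq.mpr hbot
    exact ⟨hA.isDomain, [], by simpa using hbot.symm, .nil A A⟩
  obtain ⟨x, hx, hx2, hxmin⟩ := exists_mem_maximalIdeal hbot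
  have : Nontrivial (A ⧸ Ideal.span {x}) := Ideal.Quotient.nontrivial_iff.mpr
    (((Ideal.span_singleton_le_iff_mem _).mpr hx).trans_lt
      (maximalIdeal.isMaximal A).ne_top.lt_top).ne
  have : IsLocalRing (A ⧸ Ideal.span {x}) :=
    .of_surjective' (Ideal.Quotient.mk _) Ideal.Quotient.mk_surjective
  have hmap : (maximalIdeal A).map (Ideal.Quotient.mk (Ideal.span {x})) =
      maximalIdeal (A ⧸ Ideal.span {x}) :=
    map_maximalIdeal_of_surjective _ Ideal.Quotient.mk_surjective
  have hlt := spanFinrank_maximalIdeal_quotient_lt hx hx2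
  rw [hmap] at hlt
  have hreg : IsRegularLocalRing (A ⧸ Ideal.span {x}) := by
    apply of_spanFinrank_maximalIdeal_le
    have hdim := ringKrullDim_le_ringKrullDim_quotSMulTop_succ hx
    have hxtop : (x • ⊤ : Ideal A) = Ideal.span {x} := by
      simp [← Submodule.ideal_span_singleton_smul]
    rw [← spanFinrank_maximalIdeal, ringKrullDim_eq_of_ringEquiv (Ideal.quotEquivOfEq hxtop)]
      at hdim
    have hlt' : (((maximalIdeal (A ⧸ Ideal.span {x})).spanFinrank : ℕ∞) : WithBot ℕ∞) + 1 ≤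
        ((maximalIdeal A).spanFinrank : ℕ∞) := by
      exact_mod_cast Nat.succ_le_of_lt hlt
    exact ENat.WithBot.add_le_add_one_right_iff.mp (hlt'.trans hdim)
  obtain ⟨hdom, rs, hrs, hrsreg⟩ := ih _ hlt (A ⧸ Ideal.span {x}) rfl
  have hprime : (Ideal.span {x}).IsPrime := (Ideal.Quotient.isDomain_iff_prime _).mp hdom
  have hdomA : IsDomain A := by
    obtain ⟨Q, hQ, hQx⟩ := Ideal.exists_minimalPrimes_le (bot_le (a := Ideal.span {x}))
    have hQp : Q.IsPrime := hQ.1.1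
    have hQbot : Q = ⊥ := by
      refine Submodule.eq_bot_of_le_smul_of_le_jacobson_bot (Ideal.span {x}) Q
        (IsNoetherian.noetherian _) (fun q hq ↦ ?_) ?_
      · obtain ⟨a, rfl⟩ := Ideal.mem_span_singleton'.mp (hQx hq)
        rw [mul_comm]
        exact Ideal.mul_mem_mul (Ideal.mem_span_singleton_self x)
          ((hQp.mem_or_mem hq).resolve_right (hxmin Q hQ))
      · exact ((Ideal.span_singleton_le_iff_mem _).mpr hx).trans (maximalIdeal_le_jacobson _)
    subst hQbot
    exact IsDomain.of_bot_isPrime A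
  refine ⟨hdomA, ?_⟩
  obtain ⟨rs, rfl⟩ := List.map_surjective_iff.mpr
    (Ideal.Quotient.mk_surjective (I := Ideal.span {x})) rs
  refine ⟨x :: rs, ?_, ?_⟩
  · rw [← Ideal.map_ofList, ← hmap] at hrs
    have h := congrArg (Ideal.comap (Ideal.Quotient.mk (Ideal.span {x}))) hrs
    rw [Ideal.comap_map_of_surjective _ Ideal.Quotient.mk_surjective,
      Ideal.comap_map_of_surjective _ Ideal.Quotient.mk_surjective, ← RingHom.ker_eq_comap_bot,
      Ideal.mk_ker, sup_of_le_left ((Ideal.span_singleton_le_iff_mem _).mpr hx)] at h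
    rw [Ideal.ofList_cons, sup_comm, h]
  · refine .cons' ?_ ?_
    · have hx0 : x ≠ 0 := fun h ↦ hx2 (h ▸ zero_mem _)
      exact (IsRegular.of_ne_zero hx0).left.isSMulRegular
    · have hxtop : (x • ⊤ : Submodule A A) = Ideal.span {x} := by
        simp [← Submodule.ideal_span_singleton_smul]
      let e : (A ⧸ Ideal.span {x}) ≃ₗ[A ⧸ Ideal.span {x}] QuotSMulTop x A :=
        (Submodule.quotEquivOfEq _ _ hxtop.symm).extendScalarsOfSurjective
          Ideal.Quotient.mk_surjective
      exact (e.isWeaklyRegular_congr _).mp hrsreg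

/-- The `e`-th iterated Frobenius pushforward of `A`: the additive group of `A`, on which a
ring `R` with `Algebra R A` acts through the `p ^ e`-th power map. -/
def FrobeniusPushforward (_p _e : ℕ) (A : Type*) : Type _ := A

namespace FrobeniusPushforward

variable {p e : ℕ} {R A : Type*} [CommRing R] [CommRing A] [Algebra R A]

instance : AddCommGroup (FrobeniusPushforward p e A) := inferInstanceAs (AddCommGroup A)

variable (p e A) in
/-- The identity map, as an additive equivalence onto the Frobenius pushforward. -/
def of : A ≃+ FrobeniusPushforward p e A := AddEquiv.refl A

variable [ExpChar A p]

instance : Module R (FrobeniusPushforward p e A) :=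
  Module.compHom (R := A) A ((iterateFrobenius A p e).comp (algebraMap R A))

theorem smul_of (r : R) (x : A) :
    r • of p e A x = of p e A (algebraMap R A r ^ p ^ e * x) := rfl

theorem self_smul_of (r x : A) : r • of p e A x = of p e A (r ^ p ^ e * x) := rfl

instance : IsScalarTower R A (FrobeniusPushforward p e A) where
  smul_assoc r a x := by
    obtain ⟨x, rfl⟩ := (of p e A).surjective x
    rw [self_smul_of, self_smul_of, smul_of, Algebra.smul_def, mul_pow, mul_assoc]

theorem finite_self [ExpChar R p] (h : (frobenius R p).Finite) :
    Module.Finite R (FrobeniusPushforward p e R) := by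
  have h' : (iterateFrobenius R p e).Finite := by
    induction e with
    | zero =>
      rw [iterateFrobenius_zero]
      exact .id R
    | succ e ih =>
      rw [iterateFrobenius_add, iterateFrobenius_one]
      exact ih.comp h
  exact h'

variable (p e R A) in
/-- The `R`-linear map of Frobenius pushforwards induced by `algebraMap R A`. -/
def map [ExpChar R p] : FrobeniusPushforward p e R →ₗ[R] FrobeniusPushforward p e A where
  toFun x := of p e A (algebraMap R A ((of p e R).symm x))
  map_add' x y := by simp only [map_add]
  map_smul' r x := by
    obtain ⟨x, rfl⟩ := (of p e R).surjective x
    rw [self_smul_of, AddEquiv.symm_apply_apply, AddEquiv.symm_apply_apply, RingHom.id_apply,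
      smul_of, map_mul, map_pow]

theorem map_of [ExpChar R p] (x : R) :
    map p e R A (of p e R x) = of p e A (algebraMap R A x) := rfl

theorem finite_of_isLocalization (S : Submonoid R) [IsLocalization S A] [ExpChar R p]
    [Module.Finite R (FrobeniusPushforward p e R)] :
    Module.Finite A (FrobeniusPushforward p e A) := by
  obtain ⟨s, hs⟩ := Module.Finite.fg_top (R := R) (M := FrobeniusPushforward p e R)
  refine ⟨(Submodule.fg_def.mpr ⟨map p e R A '' s, s.finite_toSet.image _, ?_⟩)⟩
  have hle : Submodule.map (map p e R A) ⊤ ≤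
      (Submodule.span A (map p e R A '' s)).restrictScalars R := by
    rw [← hs, Submodule.map_span]
    exact Submodule.span_le_restrictScalars _ _ _
  refine eq_top_iff.mpr fun x _ ↦ ?_
  obtain ⟨x, rfl⟩ := (of p e A).surjective x
  obtain ⟨a, t, rfl⟩ := IsLocalization.exists_mk'_eq S x
  have ht := IsLocalization.mk'_spec' A (1 : R) t
  have key : of p e A (IsLocalization.mk' A a t) =
      IsLocalization.mk' A (1 : R) t • map p e R A (of p e R ((t : R) ^ (p ^ e - 1) * a)) := by
    have hq : p ^ e - 1 + 1 = p ^ e := Nat.sub_add_cancel (Nat.one_le_iff_ne_zero.mpr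
      (pow_ne_zero _ (expChar_pos A p).ne'))
    rw [map_of, self_smul_of]
    congr 1
    rw [IsLocalization.mk'_eq_mul_mk'_one, map_mul, map_pow, ← hq, pow_succ, Nat.add_sub_cancel]
    calc _ = 1 ^ (p ^ e - 1) * (algebraMap R A a * IsLocalization.mk' A (1 : R) t) := by
          rw [one_pow, one_mul]
      _ = (algebraMap R A t * IsLocalization.mk' A (1 : R) t) ^ (p ^ e - 1) *
          (algebraMap R A a * IsLocalization.mk' A (1 : R) t) := by rw [ht, map_one]
      _ = _ := by ring
  rw [key]
  exact Submodule.smul_mem _ _ (hle (Submodule.mem_map_of_mem trivial))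

/-- The forward half of Kunz's theorem, for `F`-finite regular local rings. -/
theorem free_of_isRegularLocalRing [IsRegularLocalRing A]
    [Module.Finite A (FrobeniusPushforward p e A)] :
    Module.Free A (FrobeniusPushforward p e A) := by
  obtain ⟨-, rs, hrs, hreg⟩ := IsRegularLocalRing.isDomain_and_exists_isWeaklyRegular A
  refine Module.free_of_isWeaklyRegular_of_ofList_eq_maximalIdeal rs hrs ?_
  have h := IsWeaklyRegular.map_pow_append (p ^ e) (pow_ne_zero _ (expChar_pos A p).ne') rs []
    (fun r hr ↦ hrs ▸ Ideal.subset_span (by simpa using hr)) (by simpa using hreg)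
  rw [List.append_nil] at h
  refine ((of p e A).isWeaklyRegular_congr ?_).mp h
  rw [List.forall₂_map_left_iff, List.forall₂_same]
  intro r _ x
  rw [self_smul_of, smul_eq_mul]

theorem exists_linearMap_apply_eq_one [IsRegularLocalRing A]
    [Module.Finite A (FrobeniusPushforward p e A)] {c : A} (hc : c ∉ maximalIdeal A ^ p ^ e) :
    ∃ φ : FrobeniusPushforward p e A →ₗ[A] A, φ (of p e A c) = 1 := by
  have := free_of_isRegularLocalRing (p := p) (e := e) (A := A)
  let b := Module.Free.chooseBasis A (FrobeniusPushforward p e A)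
  obtain ⟨i, hi⟩ : ∃ i, IsUnit (b.repr (of p e A c) i) := by
    by_contra! hcon
    refine hc ?_
    have hsum := congrArg (of p e A).symm (b.sum_repr (of p e A c))
    rw [map_sum, AddEquiv.symm_apply_apply] at hsum
    rw [← hsum]
    refine Ideal.sum_mem _ fun i _ ↦ ?_
    obtain ⟨y, hy⟩ := (of p e A).surjective (b i)
    rw [← hy, self_smul_of, AddEquiv.symm_apply_apply]
    exact Ideal.mul_mem_right _ _
      (Ideal.pow_mem_pow ((mem_maximalIdeal _).mpr (hcon i)) _)
  obtain ⟨u, hu⟩ := hi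
  exact ⟨(↑u⁻¹ : A) • b.coord i, by simp [← hu]⟩

variable (p e) in
/-- The ideal of values at `c` of the `p⁻ᵉ`-linear endomorphisms of `R`. -/
def traceIdeal [ExpChar R p] (c : R) : Ideal R :=
  LinearMap.range (LinearMap.applyₗ (M₂ := R) (of p e R c))

theorem mem_traceIdeal [ExpChar R p] {c x : R} :
    x ∈ traceIdeal p e c ↔
      ∃ φ : FrobeniusPushforward p e R →ₗ[R] R, φ (of p e R c) = x := Iff.rfl

theorem traceIdeal_not_le [ExpChar R p] [IsNoetherianRing R] (h : (frobenius R p).Finite)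
    (P : Ideal R) [P.IsPrime] [IsLocalization.AtPrime A P] [IsRegularLocalRing A]
    {c : R} (hc : algebraMap R A c ∉ maximalIdeal A ^ p ^ e) : ¬ traceIdeal p e c ≤ P := by
  have := finite_self (e := e) h
  have := Module.finitePresentation_of_finite R (FrobeniusPushforward p e R)
  have := finite_of_isLocalization (p := p) (e := e) (A := A) P.primeCompl
  obtain ⟨φ, hφ⟩ := exists_linearMap_apply_eq_one hc
  obtain ⟨ψ, s, hψ⟩ := Module.FinitePresentation.exists_lift_of_isLocalizedModule P.primeCompl
    (Algebra.linearMap R A) (φ.restrictScalars R ∘ₗ map p e R A)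
  have hs : algebraMap R A (ψ (of p e R c)) = algebraMap R A s := by
    simpa [map_of, hφ, Submonoid.smul_def, Algebra.smul_def] using
      LinearMap.congr_fun hψ (of p e R c)
  intro hle
  have hmem : ψ (of p e R c) ∈ P := hle ⟨ψ, rfl⟩
  rw [← IsLocalization.AtPrime.to_map_mem_maximal_iff A P, hs,
    IsLocalization.AtPrime.to_map_mem_maximal_iff A P] at hmem
  exact s.2 hmem

theorem traceIdeal_le_succ [ExpChar R p] (h : traceIdeal p 1 (1 : R) = ⊤) (c : R) :
    traceIdeal p e c ≤ traceIdeal p (e + 1) c := by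
  obtain ⟨φ, hφ⟩ := mem_traceIdeal.mp (h ▸ Submodule.mem_top : (1 : R) ∈ traceIdeal p 1 (1 : R))
  rintro _ ⟨ψ, rfl⟩
  set u := ψ (of p e R c)
  refine ⟨{ toFun := fun x ↦ φ (of p 1 R (u ^ (p - 1) * ψ (of p e R ((of p (e + 1) R).symm x))))
            map_add' := fun x y ↦ by simp only [map_add, mul_add]
            map_smul' := fun r x ↦ ?_ }, ?_⟩
  · obtain ⟨x, rfl⟩ := (of p (e + 1) R).surjective x
    rw [self_smul_of, AddEquiv.symm_apply_apply, AddEquiv.symm_apply_apply, RingHom.id_apply,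
      ← map_smul, self_smul_of, pow_succ, mul_comm (p ^ e) p, pow_mul, ← self_smul_of, map_smul,
      smul_eq_mul, pow_one, mul_left_comm]
  · change φ (of p 1 R (u ^ (p - 1) * ψ (of p e R c))) = u
    have hu : of p 1 R (u ^ p) = u • of p 1 R 1 := by rw [self_smul_of, pow_one, mul_one]
    rw [← pow_succ, Nat.sub_add_cancel (expChar_pos R p), hu, map_smul, hφ, smul_eq_mul, mul_one]

end FrobeniusPushforward

theorem IsRegularCommRing.isRegularLocalRing {R : Type u} [CommRing R] [IsNoetherianRing R]
    (h : IsRegularCommRing R) (P : Ideal R) [P.IsPrime] :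
    IsRegularLocalRing (Localization.AtPrime P) := by
  obtain ⟨s, hs, hcard⟩ := h P
  refine IsRegularLocalRing.of_spanFinrank_maximalIdeal_le _ ?_
  have hle := Submodule.spanFinrank_span_le_ncard_of_finite
    (R := Localization.AtPrime P) s.finite_toSet
  rw [Set.ncard_coe_finset] at hle
  rw [← hs, ← hcard]
  exact Nat.mono_cast (α := WithBot ℕ∞) hle

theorem IsLocalization.AtPrime.algebraMap_ne_zero_of_notMem_minimalPrimes {R : Type*} [CommRing R]
    (P : Ideal R) [P.IsPrime] (A : Type*) [CommRing A] [Algebra R A]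
    [IsLocalization.AtPrime A P] {c : R} (hc : ∀ Q ∈ minimalPrimes R, c ∉ Q) :
    algebraMap R A c ≠ 0 := by
  intro h0
  obtain ⟨s, hs⟩ := (IsLocalization.map_eq_zero_iff P.primeCompl A c).mp h0
  obtain ⟨Q, hQ, hQP⟩ := Ideal.exists_minimalPrimes_le (bot_le (a := P))
  have hQprime : Q.IsPrime := hQ.1.1
  rcases hQprime.mem_or_mem (hs ▸ zero_mem Q) with h | h
  · exact s.2 (hQP h)
  · exact hc Q hQ h

theorem exists_notMem_maximalIdeal_pow {A : Type*} [CommRing A] [IsLocalRing A]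
    [IsNoetherianRing A] {p : ℕ} (hp : 1 < p) {c : A} (hc : c ≠ 0) :
    ∃ e : ℕ, c ∉ maximalIdeal A ^ p ^ (e + 1) := by
  by_contra! hcon
  refine hc ((Submodule.mem_bot A).mp ?_)
  rw [← Ideal.iInf_pow_eq_bot_of_isLocalRing (maximalIdeal A) (maximalIdeal.isMaximal A).ne_top,
    Submodule.mem_iInf]
  exact fun i ↦ Ideal.pow_le_pow_right
    ((Nat.lt_pow_self hp).le.trans (Nat.pow_le_pow_right hp.le i.le_succ)) (hcon i)

open FrobeniusPushforward in
/-- **Hochster–Huneke.** An `F`-finite reduced Noetherian regular ring of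
characteristic `p > 0` is strongly `F`-regular. -/
theorem stronglyFRegular_of_regular
    (p : ℕ) (hp : p.Prime) (R : Type u) [CommRing R] [IsNoetherianRing R] [ExpChar R p]
    (hred : IsReduced R) (hFfinite : (frobenius R p).Finite)
    (hreg : IsRegularCommRing R) :
    StronglyFRegular p R := by
  intro c hc
  have hA (P : Ideal R) [P.IsPrime] : ExpChar (Localization.AtPrime P) p := by
    have hpR : (p : R) = 0 := by
      rcases ‹ExpChar R p› with _ | _
      · exact absurd hp Nat.not_prime_one
      · exact CharP.cast_eq_zero R p
    have := ringChar.of_eq (CharP.ringChar_of_prime_eq_zero (R := Localization.AtPrime P) hp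
      (by rw [← map_natCast (algebraMap R _), hpR, map_zero]))
    exact .prime hp
  have hlocal := hreg.isRegularLocalRing
  have hsplit : traceIdeal p 1 (1 : R) = ⊤ := by
    by_contra hne
    obtain ⟨P, hP, hle⟩ := Ideal.exists_le_maximal _ hne
    refine traceIdeal_not_le (A := Localization.AtPrime P) hFfinite P ?_ hle
    rw [map_one, pow_one]
    exact fun h ↦ (maximalIdeal.isMaximal _).ne_top
      ((Ideal.eq_top_iff_one _).mpr (Ideal.pow_le_self hp.ne_zero h))
  have hmono : Monotone fun e ↦ traceIdeal p (e + 1) c :=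
    monotone_nat_of_le_succ fun e ↦ traceIdeal_le_succ hsplit c
  have hsup : ⨆ e, traceIdeal p (e + 1) c = ⊤ := by
    by_contra hne
    obtain ⟨P, hP, hle⟩ := Ideal.exists_le_maximal _ hne
    obtain ⟨e, he⟩ := exists_notMem_maximalIdeal_pow hp.one_lt
      (IsLocalization.AtPrime.algebraMap_ne_zero_of_notMem_minimalPrimes P
        (Localization.AtPrime P) hc)
    exact traceIdeal_not_le hFfinite P he ((le_iSup _ e).trans hle)
  obtain ⟨e, φ, hφ⟩ := (Submodule.mem_iSup_of_directed _ hmono.directed_le).mp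
    (hsup ▸ Submodule.mem_top : (1 : R) ∈ ⨆ e, traceIdeal p (e + 1) c)
  refine ⟨e + 1, φ.toAddMonoidHom.comp (of p (e + 1) R).toAddMonoidHom, e.succ_pos,
    fun r x ↦ ?_, hφ⟩
  change φ (of p (e + 1) R (r ^ p ^ (e + 1) * x)) = r * φ (of p (e + 1) R x)
  rw [← self_smul_of, map_smul, smul_eq_mul]
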